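/- Stabilizer and logical operators of a GCQC (Proposition 1): In the GCQC setup, the symplectic dual of the GCQC stabilizer is obtained by adjoining the replacement images of the duals of the outer codes: S_𝒞^⊥ = S_𝒞 + φ₁(S_{A₁}^⊥) + ⋯ + φ_m(S_{A_m}^⊥). In particular, every logical operator of the GCQC is, modulo S_𝒞, a sum of replacement images of logical operators of the outer codes. -/

import Mathlib

open Finset

/-- Pauli operators (up to phase) on `n` qubits, as symplectic vectors. -/
abbrev Pauli (n : ℕ) := Fin n → (ZMod 2) × (ZMod 2)

/-- The outer space `W = (𝔽₂^r × 𝔽₂^r)^N`. -/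
abbrev Outer (r N : ℕ) := Fin N → (Fin r → ZMod 2) × (Fin r → ZMod 2)

/-- `N` blocks of `n` qubits each. -/
abbrev PauliB (n N : ℕ) := Fin N → Pauli n

/-- Elementary symplectic form on one qubit. -/
def B0 : LinearMap.BilinForm (ZMod 2) ((ZMod 2) × (ZMod 2)) :=
  LinearMap.mk₂ (ZMod 2) (fun u v => u.1 * v.2 + v.1 * u.2)
    (fun a b v => by simp; ring)
    (fun c a v => by simp; ring)
    (fun a b v => by simp; ring)
    (fun c a v => by simp; ring)

/-- Sum of a bilinear form over `N` coordinates. -/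
def sumForm {M : Type*} [AddCommGroup M] [Module (ZMod 2) M] (N : ℕ)
    (B : LinearMap.BilinForm (ZMod 2) M) :
    LinearMap.BilinForm (ZMod 2) (Fin N → M) :=
  LinearMap.mk₂ (ZMod 2) (fun u v => ∑ j, B (u j) (v j))
    (fun a b v => by simp [Finset.sum_add_distrib])
    (fun c a v => by simp [Finset.mul_sum])
    (fun a b v => by simp [Finset.sum_add_distrib])
    (fun c a v => by simp [Finset.mul_sum])

/-- Symplectic form on `r`-qubit blocks written as pairs of binary `r`-vectors. -/
def pairForm (r : ℕ) : LinearMap.BilinForm (ZMod 2) ((Fin r → ZMod 2) × (Fin r → ZMod 2)) :=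
  LinearMap.mk₂ (ZMod 2) (fun u v => ∑ ℓ, (u.1 ℓ * v.2 ℓ + v.1 ℓ * u.2 ℓ))
    (fun a b v => by rw [← Finset.sum_add_distrib]; refine Finset.sum_congr rfl fun ℓ _ => by simp; ring)
    (fun c a v => by rw [smul_eq_mul, Finset.mul_sum]; refine Finset.sum_congr rfl fun ℓ _ => by simp; ring)
    (fun a b v => by rw [← Finset.sum_add_distrib]; refine Finset.sum_congr rfl fun ℓ _ => by simp; ring)
    (fun c a v => by rw [smul_eq_mul, Finset.mul_sum]; refine Finset.sum_congr rfl fun ℓ _ => by simp; ring)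

/-- Symplectic form on `Pauli n`. -/
def symplF (n : ℕ) : LinearMap.BilinForm (ZMod 2) (Pauli n) := sumForm n B0

/-- Symplectic form on `N` blocks of `n` qubits. -/
def symplFB (n N : ℕ) : LinearMap.BilinForm (ZMod 2) (PauliB n N) := sumForm N (symplF n)

/-- Symplectic form on the outer space `W_i`. -/
def symplFO (r N : ℕ) : LinearMap.BilinForm (ZMod 2) (Outer r N) := sumForm N (pairForm r)

/-- Orthogonal complement of a subspace w.r.t. a bilinear form. -/
def perp {M : Type*} [AddCommGroup M] [Module (ZMod 2) M]
    (B : LinearMap.BilinForm (ZMod 2) M) (S : Submodule (ZMod 2) M) :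
    Submodule (ZMod 2) M where
  carrier := {v | ∀ s ∈ S, B s v = 0}
  add_mem' := fun hu hv s hs => by
    rw [map_add, hu s hs, hv s hs, add_zero]
  zero_mem' := fun s hs => by simp
  smul_mem' := fun c v hv s hs => by
    rw [map_smul, hv s hs, smul_zero]

/-- Generic weight: number of nonzero coordinates. -/
def wgt {N : ℕ} {M : Type*} [Zero M] [DecidableEq M] (v : Fin N → M) : ℕ :=
  (Finset.univ.filter fun j => v j ≠ 0).card

/-- Symplectic weight on `N` blocks of `n` qubits: number of nonzero qubit positions. -/
def swtB {n N : ℕ} (v : PauliB n N) : ℕ := ∑ j, wgt (v j)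

/-- Stabilizer of the subcode `B_i`: `S` together with the logical `z`'s of index `< kk`. -/
def Sstab (n : ℕ) (S : Submodule (ZMod 2) (Pauli n)) (z : ℕ → Pauli n) (kk : ℕ) :
    Submodule (ZMod 2) (Pauli n) :=
  S ⊔ Submodule.span (ZMod 2) (z '' Set.Iio kk)

/-- Span of the logical operators `x_t, z_t` with `a ≤ t < b` (0-based indexing). -/
def Lspan (n : ℕ) (x z : ℕ → Pauli n) (a b : ℕ) : Submodule (ZMod 2) (Pauli n) :=
  Submodule.span (ZMod 2) ((x '' Set.Ico a b) ∪ (z '' Set.Ico a b))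

/-- The block-wise inner stabilizer `S_I`. -/
def SI (n N : ℕ) (S : Submodule (ZMod 2) (Pauli n)) : Submodule (ZMod 2) (PauliB n N) :=
  Submodule.pi (Set.univ : Set (Fin N)) (fun _ => S)

/-- The replacement map `φ` with offset `off`, sending the `ℓ`-th binary coordinates of each
block to the logical operators `x (off+ℓ)`, `z (off+ℓ)` of the inner code. -/
def phi (n N : ℕ) (x z : ℕ → Pauli n) (off r : ℕ) :
    Outer r N →ₗ[ZMod 2] PauliB n N where
  toFun w := fun j =>
    (∑ ℓ : Fin r, (w j).1 ℓ • x (off + ℓ)) + (∑ ℓ : Fin r, (w j).2 ℓ • z (off + ℓ))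
  map_add' := fun a b => by
    funext j
    simp [add_smul, Finset.sum_add_distrib]
    abel
  map_smul' := fun c a => by
    funext j
    simp [mul_smul, Finset.smul_sum, smul_add]

theorem symplF_comm {n : ℕ} (u v : Pauli n) : symplF n u v = symplF n v u := by
  simp only [symplF, sumForm, B0, LinearMap.mk₂_apply]
  exact Finset.sum_congr rfl fun _ _ => by ring

theorem symplFB_apply {n N : ℕ} (u v : PauliB n N) :
    symplFB n N u v = ∑ j, symplF n (u j) (v j) := rfl

theorem symplFO_apply {r N : ℕ} (u v : Outer r N) :
    symplFO r N u v = ∑ j, ∑ ℓ, ((u j).1 ℓ * (v j).2 ℓ + (v j).1 ℓ * (u j).2 ℓ) := rfl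

theorem phi_apply {n N : ℕ} (x z : ℕ → Pauli n) (off r : ℕ) (w : Outer r N) (j : Fin N) :
    phi n N x z off r w j =
      (∑ ℓ : Fin r, (w j).1 ℓ • x (off + ℓ)) + (∑ ℓ : Fin r, (w j).2 ℓ • z (off + ℓ)) := rfl

theorem mem_perp {M : Type*} [AddCommGroup M] [Module (ZMod 2) M]
    {B : LinearMap.BilinForm (ZMod 2) M} {S : Submodule (ZMod 2) M} {v : M} :
    v ∈ perp B S ↔ ∀ s ∈ S, B s v = 0 := Iff.rfl

theorem perp_antitone {M : Type*} [AddCommGroup M] [Module (ZMod 2) M]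
    (B : LinearMap.BilinForm (ZMod 2) M) : Antitone (perp B) :=
  fun _ _ h _ hv s hs => hv s (h hs)

theorem mem_perp_sup {M : Type*} [AddCommGroup M] [Module (ZMod 2) M]
    {B : LinearMap.BilinForm (ZMod 2) M} {S T : Submodule (ZMod 2) M} {v : M} :
    v ∈ perp B (S ⊔ T) ↔ v ∈ perp B S ∧ v ∈ perp B T := by
  refine ⟨fun h => ⟨perp_antitone B le_sup_left h, perp_antitone B le_sup_right h⟩, ?_⟩
  rintro ⟨hS, hT⟩ s hs
  obtain ⟨a, ha, b, hb, rfl⟩ := Submodule.mem_sup.1 hs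
  rw [map_add, LinearMap.add_apply, hS a ha, hT b hb, add_zero]

theorem mem_perp_biSup {M ι : Type*} [AddCommGroup M] [Module (ZMod 2) M]
    {B : LinearMap.BilinForm (ZMod 2) M} {s : Finset ι} {T : ι → Submodule (ZMod 2) M} {v : M} :
    v ∈ perp B (⨆ i ∈ s, T i) ↔ ∀ i ∈ s, v ∈ perp B (T i) := by
  refine ⟨fun h i hi => perp_antitone B (le_biSup T hi) h, fun h => ?_⟩
  have hle : (⨆ i ∈ s, T i) ≤ LinearMap.ker (B.flip v) :=
    iSup₂_le fun i hi t ht => h i hi t ht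
  exact fun t ht => hle ht

/-- The syndrome map: the symplectic products of each block with the logical operators `z`, `x`. -/
def syndrome {n : ℕ} (N : ℕ) (x z : ℕ → Pauli n) (off r : ℕ) (v : PauliB n N) : Outer r N :=
  fun j => (fun ℓ => symplF n (z (off + ℓ)) (v j), fun ℓ => symplF n (x (off + ℓ)) (v j))

/-- The syndrome map is adjoint to the replacement map. -/
theorem symplFB_phi {n N : ℕ} (x z : ℕ → Pauli n) (off r : ℕ) (w : Outer r N) (v : PauliB n N) :
    symplFB n N (phi n N x z off r w) v = symplFO r N w (syndrome N x z off r v) := by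
  rw [symplFB_apply, symplFO_apply]
  refine Finset.sum_congr rfl fun j _ => ?_
  simp [phi_apply, syndrome, Finset.sum_add_distrib, mul_comm]

theorem mem_perp_map_phi {n N : ℕ} {x z : ℕ → Pauli n} {off r : ℕ}
    {A : Submodule (ZMod 2) (Outer r N)} {v : PauliB n N} :
    v ∈ perp (symplFB n N) (A.map (phi n N x z off r)) ↔
      syndrome N x z off r v ∈ perp (symplFO r N) A := by
  simp [mem_perp, symplFB_phi]

theorem mem_perp_SI {n N : ℕ} {S : Submodule (ZMod 2) (Pauli n)} {v : PauliB n N} :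
    v ∈ perp (symplFB n N) (SI n N S) ↔ ∀ j, v j ∈ perp (symplF n) S := by
  constructor
  · intro h j s hs
    have hmem : (Pi.single j s : PauliB n N) ∈ SI n N S := by
      intro i _
      rcases eq_or_ne i j with rfl | hij
      · simpa using hs
      · simp [hij]
    have := h _ hmem
    rw [symplFB_apply, Finset.sum_eq_single j] at this
    · simpa using this
    · intro i _ hij
      simp [hij]
    · simp
  · intro h s hs
    rw [symplFB_apply]
    exact Finset.sum_eq_zero fun j _ => h j _ (hs j trivial)

theorem phi_apply_mem {n N : ℕ} {x z : ℕ → Pauli n} {off r : ℕ} {P : Submodule (ZMod 2) (Pauli n)}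
    (hx : ∀ ℓ < r, x (off + ℓ) ∈ P) (hz : ∀ ℓ < r, z (off + ℓ) ∈ P) (w : Outer r N) (j : Fin N) :
    phi n N x z off r w j ∈ P := by
  rw [phi_apply]
  exact P.add_mem (P.sum_mem fun ℓ _ => P.smul_mem _ (hx ℓ ℓ.2))
    (P.sum_mem fun ℓ _ => P.smul_mem _ (hz ℓ ℓ.2))

section Logical

variable {n q : ℕ} {x z : ℕ → Pauli n}

theorem syndrome_phi_self {N off r : ℕ} (hq : off + r ≤ q)
    (hxx : ∀ s < q, ∀ t < q, symplF n (x s) (x t) = 0)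
    (hzz : ∀ s < q, ∀ t < q, symplF n (z s) (z t) = 0)
    (hxz : ∀ s < q, ∀ t < q, symplF n (x s) (z t) = if s = t then 1 else 0)
    (w : Outer r N) : syndrome N x z off r (phi n N x z off r w) = w := by
  have hlt (ℓ : Fin r) : off + ℓ < q := by omega
  have hxx' (a b : Fin r) := hxx _ (hlt a) _ (hlt b)
  have hzz' (a b : Fin r) := hzz _ (hlt a) _ (hlt b)
  have hxz' (a b : Fin r) := hxz _ (hlt a) _ (hlt b)
  have hzx' (a b : Fin r) := (symplF_comm _ _).trans (hxz' a b)
  funext j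
  refine Prod.ext (funext fun ℓ => ?_) (funext fun ℓ => ?_) <;>
    simp [syndrome, phi_apply, hxx', hzz', hxz', hzx', Fin.val_inj]

theorem syndrome_phi_of_disjoint {N off r off' r' : ℕ} (hq : off + r ≤ q) (hq' : off' + r' ≤ q)
    (hdisj : off + r ≤ off' ∨ off' + r' ≤ off)
    (hxx : ∀ s < q, ∀ t < q, symplF n (x s) (x t) = 0)
    (hzz : ∀ s < q, ∀ t < q, symplF n (z s) (z t) = 0)
    (hxz : ∀ s < q, ∀ t < q, symplF n (x s) (z t) = if s = t then 1 else 0)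
    (w : Outer r N) : syndrome N x z off' r' (phi n N x z off r w) = 0 := by
  have hlt (ℓ : Fin r) : off + ℓ < q := by omega
  have hlt' (ℓ : Fin r') : off' + ℓ < q := by omega
  have hxx' (a : Fin r') (b : Fin r) := hxx _ (hlt' a) _ (hlt b)
  have hzz' (a : Fin r') (b : Fin r) := hzz _ (hlt' a) _ (hlt b)
  have hxz' (a : Fin r') (b : Fin r) : symplF n (x (off' + a)) (z (off + b)) = 0 := by
    rw [hxz _ (hlt' a) _ (hlt b), if_neg (by omega)]
  have hzx' (a : Fin r') (b : Fin r) : symplF n (z (off' + a)) (x (off + b)) = 0 := by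
    rw [symplF_comm, hxz _ (hlt b) _ (hlt' a), if_neg (by omega)]
  funext j
  refine Prod.ext (funext fun ℓ => ?_) (funext fun ℓ => ?_) <;>
    simp [syndrome, phi_apply, hxx', hzz', hxz', hzx']

theorem syndrome_of_mem_SI {N off r : ℕ} {S : Submodule (ZMod 2) (Pauli n)} (hq : off + r ≤ q)
    (hxS : ∀ t < q, x t ∈ perp (symplF n) S) (hzS : ∀ t < q, z t ∈ perp (symplF n) S)
    {v : PauliB n N} (hv : v ∈ SI n N S) : syndrome N x z off r v = 0 := by
  funext j
  refine Prod.ext (funext fun ℓ => ?_) (funext fun ℓ => ?_)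
  · exact (symplF_comm _ _).trans (hzS (off + ℓ) (by omega) _ (hv j trivial))
  · exact (symplF_comm _ _).trans (hxS (off + ℓ) (by omega) _ (hv j trivial))

/-- Subtracting from an element of `S ⊔ Lspan n x z 0 q` its logical part leaves an
element of `S`. -/
theorem sub_logical_mem {S : Submodule (ZMod 2) (Pauli n)}
    (hxS : ∀ t < q, x t ∈ perp (symplF n) S) (hzS : ∀ t < q, z t ∈ perp (symplF n) S)
    (hxx : ∀ s < q, ∀ t < q, symplF n (x s) (x t) = 0)
    (hzz : ∀ s < q, ∀ t < q, symplF n (z s) (z t) = 0)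
    (hxz : ∀ s < q, ∀ t < q, symplF n (x s) (z t) = if s = t then 1 else 0)
    {u : Pauli n} (hu : u ∈ S ⊔ Lspan n x z 0 q) :
    u - ∑ t ∈ Finset.range q, (symplF n (z t) u • x t + symplF n (x t) u • z t) ∈ S := by
  let P : Pauli n →ₗ[ZMod 2] Pauli n := LinearMap.id -
    ∑ t ∈ Finset.range q, ((symplF n (z t)).smulRight (x t) + (symplF n (x t)).smulRight (z t))
  have hP (u : Pauli n) : P u =
      u - ∑ t ∈ Finset.range q, (symplF n (z t) u • x t + symplF n (x t) u • z t) := by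
    simp [P]
  suffices S ⊔ Lspan n x z 0 q ≤ S.comap P by
    rw [← hP]
    exact this hu
  refine sup_le (fun s hs => ?_) (Submodule.span_le.2 ?_)
  · rw [Submodule.mem_comap, hP, Finset.sum_eq_zero, sub_zero]
    · exact hs
    · intro t ht
      have ht := Finset.mem_range.1 ht
      rw [symplF_comm, hzS t ht s hs, symplF_comm, hxS t ht s hs, zero_smul, zero_smul, add_zero]
  · rintro _ (⟨t, ⟨-, ht⟩, rfl⟩ | ⟨t, ⟨-, ht⟩, rfl⟩) <;>
      rw [SetLike.mem_coe, Submodule.mem_comap, hP, Finset.sum_eq_single_of_mem t (by simpa using ht)]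
    · simp [symplF_comm (z t), hxz t ht t ht, hxx t ht t ht]
    · intro s hs hst
      have hs := Finset.mem_range.1 hs
      rw [symplF_comm (z s), hxz t ht s hs, hxx s hs t ht, if_neg hst.symm, zero_smul, zero_smul,
        add_zero]
    · simp [hxz t ht t ht, hzz t ht t ht]
    · intro s hs hst
      have hs := Finset.mem_range.1 hs
      rw [hzz s hs t ht, hxz s hs t ht, if_neg hst, zero_smul, zero_smul, add_zero]

end Logical

theorem sum_blocks_eq_sum_range {M : Type*} [AddCommMonoid M] (k : ℕ → ℕ) {m : ℕ}
    (hk : ∀ i, 1 ≤ i → i ≤ m → k (i + 1) ≤ k i) (f : ℕ → M) :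
    ∑ i ∈ Finset.Icc 1 m, ∑ ℓ : Fin (k i - k (i + 1)), f (k 1 - k i + ℓ) =
      ∑ t ∈ Finset.range (k 1 - k (m + 1)), f t := by
  suffices k (m + 1) ≤ k 1 ∧ ∑ i ∈ Finset.Icc 1 m, ∑ ℓ : Fin (k i - k (i + 1)),
      f (k 1 - k i + ℓ) = ∑ t ∈ Finset.range (k 1 - k (m + 1)), f t from this.2
  induction m with
  | zero => simp
  | succ m ih =>
    obtain ⟨hle, ih⟩ := ih fun i h1 hi => hk i h1 (by omega)
    have hstep := hk (m + 1) (by omega) le_rfl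
    refine ⟨hstep.trans hle, ?_⟩
    rw [Finset.sum_Icc_succ_top (by omega), ih,
      Fin.sum_univ_eq_sum_range (fun ℓ => f (k 1 - k (m + 1) + ℓ)), ← Finset.sum_range_add]
    congr 2
    omega

/-- Proposition 1: the symplectic dual of the GCQC stabilizer is obtained by adjoining
the replacement images of the duals of the outer codes. -/
theorem gcqc_dual
    (n N m : ℕ) (hm : 1 ≤ m)
    (k : ℕ → ℕ) (hk : ∀ i, 1 ≤ i → i ≤ m → k (i + 1) < k i) (hklast : k (m + 1) = 0)
    (hkn : k 1 ≤ n)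
    (S : Submodule (ZMod 2) (Pauli n))
    (hSorth : S ≤ perp (symplF n) S)
    (hSdim : Module.finrank (ZMod 2) S = n - k 1)
    (x z : ℕ → Pauli n)
    (hxS : ∀ t < k 1, x t ∈ perp (symplF n) S)
    (hzS : ∀ t < k 1, z t ∈ perp (symplF n) S)
    (hxx : ∀ s < k 1, ∀ t < k 1, symplF n (x s) (x t) = 0)
    (hzz : ∀ s < k 1, ∀ t < k 1, symplF n (z s) (z t) = 0)
    (hxz : ∀ s < k 1, ∀ t < k 1, symplF n (x s) (z t) = if s = t then 1 else 0)
    (hdual : perp (symplF n) S = S ⊔ Lspan n x z 0 (k 1))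
    (hdisj : Disjoint S (Lspan n x z 0 (k 1)))
    (d : ℕ → ℕ)
    (hd : ∀ i, 1 ≤ i → i ≤ m + 1 → ∀ v ∈ perp (symplF n) (Sstab n S z (k 1 - k i)),
      v ∉ Sstab n S z (k 1 - k i) → d i ≤ wgt v)
    (K D : ℕ → ℕ) (hKN : ∀ i, 1 ≤ i → i ≤ m → K i ≤ N)
    (SA : ∀ i : ℕ, Submodule (ZMod 2) (Outer (k i - k (i + 1)) N))
    (hSAorth : ∀ i, 1 ≤ i → i ≤ m → SA i ≤ perp (symplFO (k i - k (i + 1)) N) (SA i))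
    (hSAdim : ∀ i, 1 ≤ i → i ≤ m →
      Module.finrank (ZMod 2) (SA i) = (k i - k (i + 1)) * (N - K i))
    (hSAdist : ∀ i, 1 ≤ i → i ≤ m → ∀ w ∈ perp (symplFO (k i - k (i + 1)) N) (SA i),
      w ∉ SA i → D i ≤ wgt w)
    (SC : Submodule (ZMod 2) (PauliB n N))
    (hSC : SC = SI n N S ⊔ ⨆ i ∈ Finset.Icc 1 m,
      Submodule.map (phi n N x z (k 1 - k i) (k i - k (i + 1))) (SA i)) :
    perp (symplFB n N) SC
      = SC ⊔ ⨆ i ∈ Finset.Icc 1 m,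
          Submodule.map (phi n N x z (k 1 - k i) (k i - k (i + 1)))
            (perp (symplFO (k i - k (i + 1)) N) (SA i)) := by
  have hk_anti (a b : ℕ) (ha : 1 ≤ a) (hab : a ≤ b) (hb : b ≤ m + 1) : k b ≤ k a := by
    induction b, hab using Nat.le_induction with
    | base => exact le_rfl
    | succ b hab ih => exact (hk b (by omega) (by omega)).le.trans (ih (by omega))
  have hrange (i : ℕ) (hi : i ∈ Finset.Icc 1 m) :
      k 1 - k i + (k i - k (i + 1)) ≤ k 1 := by
    have hi := Finset.mem_Icc.1 hi
    have := hk_anti 1 i le_rfl hi.1 (by omega)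
    omega
  have hphi_perp (i : ℕ) (hi : i ∈ Finset.Icc 1 m) (w : Outer (k i - k (i + 1)) N)
      (hw : w ∈ perp (symplFO (k i - k (i + 1)) N) (SA i)) :
      phi n N x z (k 1 - k i) (k i - k (i + 1)) w ∈ perp (symplFB n N) SC := by
    rw [hSC, mem_perp_sup, mem_perp_biSup, mem_perp_SI]
    have hri := hrange i hi
    refine ⟨fun j => phi_apply_mem (fun ℓ hℓ => hxS _ (by omega)) (fun ℓ hℓ => hzS _ (by omega))
      w j, fun i' hi' => mem_perp_map_phi.2 ?_⟩
    rcases eq_or_ne i i' with rfl | hne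
    · rwa [syndrome_phi_self hri hxx hzz hxz]
    · rw [syndrome_phi_of_disjoint hri (hrange i' hi') ?_ hxx hzz hxz]
      · exact zero_mem _
      · rw [Finset.mem_Icc] at hi hi'
        have h1 := hk_anti 1 i le_rfl hi.1 (by omega)
        have h2 := hk_anti 1 i' le_rfl hi'.1 (by omega)
        have h3 := hk i hi.1 hi.2
        have h4 := hk i' hi'.1 hi'.2
        rcases lt_or_gt_of_ne hne with h | h
        · have := hk_anti (i + 1) i' (by omega) h (by omega)
          omega
        · have := hk_anti (i' + 1) i (by omega) h (by omega)
          omega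
  apply le_antisymm
  · intro v hv
    have hv' := hv
    rw [hSC, mem_perp_sup, mem_perp_biSup, mem_perp_SI] at hv'
    obtain ⟨hvS, hvA⟩ := hv'
    set L : PauliB n N := ∑ i ∈ Finset.Icc 1 m, phi n N x z (k 1 - k i) (k i - k (i + 1))
      (syndrome N x z (k 1 - k i) (k i - k (i + 1)) v) with hL
    have hvL : v - L ∈ SI n N S := by
      intro j _
      have hLj : L j = ∑ t ∈ Finset.range (k 1),
          (symplF n (z t) (v j) • x t + symplF n (x t) (v j) • z t) := by
        have := sum_blocks_eq_sum_range k (fun i h1 hi => (hk i h1 hi).le)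
          (fun t => symplF n (z t) (v j) • x t + symplF n (x t) (v j) • z t)
        rw [hklast, Nat.sub_zero] at this
        rw [← this, hL, Finset.sum_apply]
        exact Finset.sum_congr rfl fun i _ => by
          rw [phi_apply, Finset.sum_add_distrib]
          rfl
      rw [Pi.sub_apply, hLj]
      exact sub_logical_mem hxS hzS hxx hzz hxz (hdual ▸ hvS j)
    rw [← sub_add_cancel v L]
    refine Submodule.add_mem_sup ((hSC ▸ le_sup_left : SI n N S ≤ SC) hvL) ?_
    exact Submodule.sum_mem _ fun i hi => Submodule.mem_iSup_of_mem i <|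
      Submodule.mem_iSup_of_mem hi <| Submodule.mem_map_of_mem (mem_perp_map_phi.1 (hvA i hi))
  · refine sup_le ?_ (iSup₂_le fun i hi => Submodule.map_le_iff_le_comap.2 (hphi_perp i hi))
    nth_rewrite 1 [hSC]
    refine sup_le (fun s hs => ?_) (iSup₂_le fun i hi => Submodule.map_le_iff_le_comap.2
      fun w hw => hphi_perp i hi w ?_)
    · rw [hSC, mem_perp_sup, mem_perp_biSup, mem_perp_SI]
      refine ⟨fun j => hSorth (hs j trivial), fun i hi => mem_perp_map_phi.2 ?_⟩
      rw [syndrome_of_mem_SI (hrange i hi) hxS hzS hs]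
      exact zero_mem _
    · rw [Finset.mem_Icc] at hi
      exact hSAorth i hi.1 hi.2 hw
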